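/- Let p be a prime, F = 𝔽_p, F̄ an algebraic closure of F, G a finite group, and J a subfield of F̄. Let W be an indecomposable FG-module and let X be an indecomposable JG-module with X | W ⊗_F J. Then there exist a finite subfield K of J and an indecomposable KG-module V such that V | W ⊗_F K and V ⊗_K J ≅ X as JG-modules. -/

import Mathlib

set_option synthInstance.maxHeartbeats 1600000
set_option maxHeartbeats 1600000

open TensorProduct

/-- Base change of a representation along a (commutative) algebra `k → L`:
the `L`-linear representation of `G` on `V ⊗_k L = L ⊗[k] V`. -/
noncomputable def repBaseChange {k : Type*} [CommRing k] (L : Type*) [CommRing L] [Algebra k L]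
    {G : Type*} [Monoid G] {V : Type*} [AddCommGroup V] [Module k V]
    (ρ : Representation k G V) : Representation L G (L ⊗[k] V) :=
  (Module.End.baseChangeHom k L V).toRingHom.toMonoidHom.comp ρ

/-- Restriction of scalars `Res_K` of a representation along `K ⊆ L`. -/
def repRes (K : Type*) {L : Type*} [CommRing K] [CommRing L] [Algebra K L]
    {G : Type*} [Monoid G] {U : Type*} [AddCommGroup U] [Module K U] [Module L U]
    [IsScalarTower K L U] (ρ : Representation L G U) : Representation K G U where
  toFun g := (ρ g).restrictScalars K
  map_one' := by ext u; simp
  map_mul' g h := by ext u; simp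

/-- Two representations of `G` over `k` are isomorphic iff the corresponding modules over the
group algebra `MonoidAlgebra k G` are linearly equivalent. -/
def RepIso {k : Type*} [CommSemiring k] {G : Type*} [Monoid G]
    {V W : Type*} [AddCommMonoid V] [Module k V] [AddCommMonoid W] [Module k W]
    (ρ : Representation k G V) (τ : Representation k G W) : Prop :=
  Nonempty (ρ.asModule ≃ₗ[MonoidAlgebra k G] τ.asModule)

/-- `ρ | τ` : `ρ` is (isomorphic to) a direct summand of `τ`, i.e. `τ` is the internal direct
sum of two submodules (over the group algebra `MonoidAlgebra k G`), the first of which is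
isomorphic to `ρ`. -/
def RepSummand {k : Type*} [CommSemiring k] {G : Type*} [Monoid G]
    {V W : Type*} [AddCommMonoid V] [Module k V] [AddCommMonoid W] [Module k W]
    (ρ : Representation k G V) (τ : Representation k G W) : Prop :=
  ∃ A B : Submodule (MonoidAlgebra k G) τ.asModule,
    IsCompl A B ∧ Nonempty (ρ.asModule ≃ₗ[MonoidAlgebra k G] A)

/-- A representation is indecomposable if it is nonzero and the corresponding module over the
group algebra is not the internal direct sum of two nonzero submodules. -/
def RepIndecomposable {k : Type*} [CommSemiring k] {G : Type*} [Monoid G]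
    {V : Type*} [AddCommMonoid V] [Module k V] (ρ : Representation k G V) : Prop :=
  Nontrivial V ∧
    ∀ A B : Submodule (MonoidAlgebra k G) ρ.asModule, IsCompl A B → A = ⊥ ∨ B = ⊥

/-- A representation is simple if the corresponding module over the group algebra is simple. -/
def RepSimple {k : Type*} [CommRing k] {G : Type*} [Monoid G]
    {V : Type*} [AddCommGroup V] [Module k V] (ρ : Representation k G V) : Prop :=
  IsSimpleModule (MonoidAlgebra k G) ρ.asModule

open Representation in
/-- Indecomposability in terms of idempotent intertwining endomorphisms. -/
theorem repIndecomposable_iff_idempotent {k : Type*} [CommRing k] {G : Type*} [Monoid G]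
    {V : Type*} [AddCommGroup V] [Module k V] (ρ : Representation k G V) :
    RepIndecomposable ρ ↔
      Nontrivial V ∧ ∀ f : IntertwiningMap ρ ρ, IsIdempotentElem f → f = 0 ∨ f = 1 := by
  refine and_congr_right fun _ => ⟨fun h f hf => ?_, fun h A B hAB => ?_⟩
  · set φ := IntertwiningMap.equivAlgEnd ρ f with hφ
    have hφi : IsIdempotentElem φ := hf.map (IntertwiningMap.equivAlgEnd ρ)
    rcases h _ _ (LinearMap.IsIdempotentElem.isCompl hφi) with h0 | h0
    · left
      apply (IntertwiningMap.equivAlgEnd ρ).injective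
      rw [map_zero]
      exact LinearMap.range_eq_bot.1 h0
    · right
      apply (IntertwiningMap.equivAlgEnd ρ).injective
      rw [map_one]
      refine LinearMap.ext fun x => LinearMap.ker_eq_bot.1 h0 ?_
      exact LinearMap.congr_fun hφi x
  · have hi := Submodule.isIdempotentElem_projection hAB
    rcases h _ (hi.map (IntertwiningMap.equivAlgEnd ρ).symm) with h0 | h0
    · left
      rw [EmbeddingLike.map_eq_zero_iff] at h0
      rw [← Submodule.range_projection hAB, h0, LinearMap.range_zero]
    · right
      rw [EmbeddingLike.map_eq_one_iff] at h0
      rw [← Submodule.ker_projection hAB, h0]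
      exact LinearMap.ker_id

open Representation in
/-- A direct summand is the same thing as a retract. -/
theorem repSummand_iff_retract {k : Type*} [CommRing k] {G : Type*} [Monoid G]
    {V W : Type*} [AddCommGroup V] [Module k V] [AddCommGroup W] [Module k W]
    (ρ : Representation k G V) (τ : Representation k G W) :
    RepSummand ρ τ ↔ ∃ (i : IntertwiningMap ρ τ) (r : IntertwiningMap τ ρ),
      ∀ v, r (i v) = v := by
  constructor
  · rintro ⟨A, B, hAB, ⟨e⟩⟩
    refine ⟨(IntertwiningMap.equivLinearMapAsModule ρ τ).symm (A.subtype ∘ₗ e.toLinearMap),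
      (IntertwiningMap.equivLinearMapAsModule τ ρ).symm
        (e.symm.toLinearMap ∘ₗ A.projectionOnto B hAB), fun v => ?_⟩
    change e.symm (A.projectionOnto B hAB (e v : τ.asModule)) = v
    rw [Submodule.projectionOnto_apply_left]
    exact e.symm_apply_apply v
  · rintro ⟨i, r, h⟩
    set i' := IntertwiningMap.equivLinearMapAsModule ρ τ i
    set r' := IntertwiningMap.equivLinearMapAsModule τ ρ r
    have h' : Function.LeftInverse r' i' := h
    have hi : IsIdempotentElem (i' ∘ₗ r') := LinearMap.ext fun x => congrArg i' (h (r x))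
    have hc := LinearMap.IsIdempotentElem.isCompl hi
    rw [LinearMap.range_comp_of_range_eq_top _
        (LinearMap.range_eq_top.2 h'.surjective),
      LinearMap.ker_comp_of_ker_eq_bot _
        (LinearMap.ker_eq_bot.2 h'.injective)] at hc
    exact ⟨_, _, hc,
      ⟨LinearEquiv.ofInjective i' h'.injective⟩⟩

open Representation in
/-- Mutually inverse intertwining maps give an isomorphism. -/
theorem RepIso.of_inverse {k : Type*} [CommRing k] {G : Type*} [Monoid G]
    {V W : Type*} [AddCommGroup V] [Module k V] [AddCommGroup W] [Module k W]
    {ρ : Representation k G V} {τ : Representation k G W}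
    (a : IntertwiningMap ρ τ) (b : IntertwiningMap τ ρ)
    (hab : ∀ w, a (b w) = w) (hba : ∀ v, b (a v) = v) : RepIso ρ τ :=
  ⟨LinearEquiv.ofLinearMap (IntertwiningMap.equivLinearMapAsModule ρ τ a)
    (IntertwiningMap.equivLinearMapAsModule τ ρ b) (LinearMap.ext hab) (LinearMap.ext hba)⟩

/-- Base change of endomorphisms along a faithfully flat extension is faithful. -/
theorem LinearMap.baseChange_injective_of_faithfullyFlat {k L : Type*} [CommRing k] [CommRing L]
    [Algebra k L] [Module.FaithfullyFlat k L] {M N : Type*} [AddCommGroup M] [Module k M]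
    [AddCommGroup N] [Module k N] :
    Function.Injective (LinearMap.baseChange L : (M →ₗ[k] N) → (L ⊗[k] M →ₗ[L] L ⊗[k] N)) := by
  intro f g h
  ext x
  apply Module.FaithfullyFlat.tensorProduct_mk_injective (A := k) (B := L) N
  simpa using LinearMap.congr_fun h (1 ⊗ₜ x)

/-- Base change of intertwining maps. -/
noncomputable def Representation.IntertwiningMap.repBaseChange {k : Type*} [CommRing k] (L : Type*)
    [CommRing L] [Algebra k L] {G : Type*} [Monoid G] {V W : Type*} [AddCommGroup V] [Module k V]
    [AddCommGroup W] [Module k W] {ρ : Representation k G V} {τ : Representation k G W}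
    (f : IntertwiningMap ρ τ) :
    IntertwiningMap (_root_.repBaseChange L ρ) (_root_.repBaseChange L τ) where
  toLinearMap := f.toLinearMap.baseChange L
  isIntertwining' g := by
    change f.toLinearMap.baseChange L ∘ₗ (ρ g).baseChange L =
      (τ g).baseChange L ∘ₗ f.toLinearMap.baseChange L
    rw [← LinearMap.baseChange_comp, ← LinearMap.baseChange_comp, f.isIntertwining']

open Representation in
/-- Indecomposability descends along field extensions. -/
theorem RepIndecomposable.of_repBaseChange {k L : Type*} [Field k] [Field L] [Algebra k L]
    {G : Type*} [Monoid G] {V : Type*} [AddCommGroup V] [Module k V] {ρ : Representation k G V}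
    (h : RepIndecomposable (repBaseChange L ρ)) : RepIndecomposable ρ := by
  rw [repIndecomposable_iff_idempotent] at h ⊢
  obtain ⟨hn, h⟩ := h
  refine ⟨?_, fun f hf => ?_⟩
  · by_contra hV
    rw [not_nontrivial_iff_subsingleton] at hV
    exact not_subsingleton (L ⊗[k] V) inferInstance
  · have hf' : IsIdempotentElem f.toLinearMap := congrArg IntertwiningMap.toLinearMap hf
    have := h (f.repBaseChange L) (IntertwiningMap.toLinearMap_injective _ _ (by
      change f.toLinearMap.baseChange L ∘ₗ f.toLinearMap.baseChange L = f.toLinearMap.baseChange L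
      rw [← LinearMap.baseChange_comp]
      exact congrArg _ hf'))
    refine this.imp (fun h0 => ?_) (fun h0 => ?_) <;>
      apply IntertwiningMap.toLinearMap_injective <;>
      apply LinearMap.baseChange_injective_of_faithfullyFlat (L := L)
    · exact (congrArg IntertwiningMap.toLinearMap h0).trans LinearMap.baseChange_zero.symm
    · exact (congrArg IntertwiningMap.toLinearMap h0).trans LinearMap.baseChange_id.symm

/-- Indecomposability is invariant under isomorphism. -/
theorem RepIndecomposable.of_repIso {k : Type*} [CommRing k] {G : Type*} [Monoid G]
    {V W : Type*} [AddCommGroup V] [Module k V] [AddCommGroup W] [Module k W]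
    {ρ : Representation k G V} {τ : Representation k G W}
    (h : RepIndecomposable τ) (e : RepIso ρ τ) : RepIndecomposable ρ := by
  obtain ⟨e⟩ := e
  obtain ⟨hn, h⟩ := h
  have : Nontrivial τ.asModule := hn
  refine ⟨e.toEquiv.nontrivial, fun A B hAB => ?_⟩
  have := h _ _ (hAB.map (Submodule.orderIsoMapComap e))
  simpa using this

/-- An endomorphism of `L ⊗ W` is defined over a finite subfield, when `L` is algebraic
over the finite field `F`. -/
theorem exists_finite_subfield_descent {F L : Type*} [Field F] [Finite F] [Field L] [Algebra F L]
    [Algebra.IsAlgebraic F L] {W : Type*} [AddCommGroup W] [Module F W] [FiniteDimensional F W]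
    (e : L ⊗[F] W →ₗ[L] L ⊗[F] W) :
    ∃ K : IntermediateField F L, Finite K ∧ ∃ f : K ⊗[F] W →ₗ[K] K ⊗[F] W,
      f.baseChange L = (AlgebraTensorModule.cancelBaseChange F K L L W).symm.toLinearMap ∘ₗ e ∘ₗ
        (AlgebraTensorModule.cancelBaseChange F K L L W).toLinearMap := by
  let b := Module.finBasis F W
  let bL := Algebra.TensorProduct.basis L b
  let S : Set L := Set.range fun ij : Fin (Module.finrank F W) × Fin (Module.finrank F W) =>
    bL.repr (e (bL ij.1)) ij.2
  let K := IntermediateField.adjoin F S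
  have : FiniteDimensional F K :=
    IntermediateField.finiteDimensional_adjoin fun x _ =>
      (Algebra.IsAlgebraic.isAlgebraic x).isIntegral
  refine ⟨K, Module.finite_of_finite F, ?_⟩
  let bK := Algebra.TensorProduct.basis K b
  let c (i j) : K := ⟨bL.repr (e (bL i)) j, IntermediateField.subset_adjoin F S ⟨(i, j), rfl⟩⟩
  refine ⟨bK.constr K fun i => ∑ j, c i j • bK j, ?_⟩
  refine (Algebra.TensorProduct.basis L bK).ext fun i => ?_
  apply (AlgebraTensorModule.cancelBaseChange F K L L W).injective
  have h1 : ∀ i, AlgebraTensorModule.cancelBaseChange F K L L W (1 ⊗ₜ bK i) = bL i := by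
    intro i
    simp [bK, bL]
  have h2 : ∀ (a : K) (x : K ⊗[F] W), (1 : L) ⊗ₜ[K] (a • x) = (a : L) • ((1 : L) ⊗ₜ[K] x) := by
    intro a x
    rw [TensorProduct.tmul_smul, TensorProduct.smul_tmul', TensorProduct.smul_tmul',
      Algebra.smul_def, smul_eq_mul]
    rfl
  rw [Algebra.TensorProduct.basis_apply, LinearMap.baseChange_tmul, Module.Basis.constr_basis,
    LinearMap.comp_apply, LinearMap.comp_apply, LinearEquiv.coe_coe, LinearEquiv.coe_coe,
    LinearEquiv.apply_symm_apply, h1, TensorProduct.tmul_sum, map_sum]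
  simp_rw [h2, map_smul, h1]
  exact bL.sum_repr _

open Representation in
/-- An intertwining idempotent splits through a representation. -/
theorem Representation.IntertwiningMap.exists_fdRep_splitting {k G V : Type} [Field k]
    [Monoid G] [AddCommGroup V] [Module k V] [FiniteDimensional k V]
    {ρ : Representation k G V} (f : IntertwiningMap ρ ρ) (hf : IsIdempotentElem f) :
    ∃ V' : FDRep k G, ∃ (j : IntertwiningMap V'.ρ ρ) (q : IntertwiningMap ρ V'.ρ),
      (∀ v, q (j v) = v) ∧ ∀ v, j (q v) = f v := by
  let σ : Representation k G (LinearMap.range f.toLinearMap) := f.range.toRepresentation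
  let j : IntertwiningMap σ ρ := ⟨(LinearMap.range f.toLinearMap).subtype, fun g => rfl⟩
  let q : IntertwiningMap ρ σ := ⟨f.toLinearMap.rangeRestrict,
    fun g => LinearMap.ext fun v => Subtype.ext (IntertwiningMap.isIntertwining _ _ f g v)⟩
  refine ⟨FDRep.of σ, j, q, ?_, fun v => rfl⟩
  rintro ⟨_, v, rfl⟩
  exact Subtype.ext (DFunLike.congr_fun hf v)

/-- Let `F = 𝔽_p`, `F̄` an algebraic closure of `F`, `J` a subfield of `F̄`, `W` an
indecomposable `FG`-module and `X` an indecomposable component of `W ⊗_F J`.  Then there are a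
finite subfield `K` of `J` and an indecomposable `KG`-module `V` with `V | W ⊗_F K` and
`V ⊗_K J ≅ X`. -/
theorem exists_finite_subfield_form_of_component (p : ℕ) [Fact p.Prime]
    (G : Type) [Group G] [Finite G]
    (J : IntermediateField (ZMod p) (AlgebraicClosure (ZMod p)))
    (W : Type) [AddCommGroup W] [Module (ZMod p) W] [FiniteDimensional (ZMod p) W]
    (ρW : Representation (ZMod p) G W) (hW : RepIndecomposable ρW)
    (X : Type) [AddCommGroup X] [Module ↥J X] [FiniteDimensional ↥J X]
    (ρX : Representation ↥J G X) (hX : RepIndecomposable ρX)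
    (hXW : RepSummand ρX (repBaseChange ↥J ρW)) :
    ∃ K : IntermediateField (ZMod p) ↥J, Finite ↥K ∧
      ∃ V : FDRep ↥K G, RepIndecomposable V.ρ ∧
        RepSummand V.ρ (repBaseChange ↥K ρW) ∧ RepIso (repBaseChange ↥J V.ρ) ρX := by
  rw [repSummand_iff_retract] at hXW
  obtain ⟨i, r, hri⟩ := hXW
  obtain ⟨K, hK, f, hf⟩ := exists_finite_subfield_descent (i.toLinearMap ∘ₗ r.toLinearMap)
  let θ := AlgebraTensorModule.cancelBaseChange (ZMod p) K J J W
  have hfx : ∀ x, θ (f.baseChange J x) = i (r (θ x)) := fun x => by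
    rw [hf]
    exact θ.apply_symm_apply _
  have hθ : ∀ g x, θ (repBaseChange J (repBaseChange K ρW) g x) = repBaseChange J ρW g (θ x) := by
    intro g x
    refine LinearMap.congr_fun (f := θ.toLinearMap ∘ₗ repBaseChange J (repBaseChange K ρW) g)
      (g := repBaseChange J ρW g ∘ₗ θ.toLinearMap) ?_ x
    ext w
    change θ (1 ⊗ₜ (1 ⊗ₜ ρW g w)) = repBaseChange J ρW g (θ (1 ⊗ₜ (1 ⊗ₜ w)))
    simp only [θ, AlgebraTensorModule.cancelBaseChange_tmul, one_smul]
    rfl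
  let Θ : Representation.IntertwiningMap (repBaseChange J (repBaseChange K ρW))
      (repBaseChange J ρW) := ⟨θ.toLinearMap, fun g => LinearMap.ext (hθ g)⟩
  let Θ' : Representation.IntertwiningMap (repBaseChange J ρW)
      (repBaseChange J (repBaseChange K ρW)) :=
    ⟨θ.symm.toLinearMap, fun g => LinearMap.ext fun x => θ.injective (by
      simp [hθ])⟩
  have hΘ : ∀ x, Θ (Θ' x) = x := θ.apply_symm_apply
  have hΘ' : ∀ x, Θ' (Θ x) = x := θ.symm_apply_apply
  let φ : Representation.IntertwiningMap (repBaseChange K ρW) (repBaseChange K ρW) :=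
    ⟨f, fun g => LinearMap.baseChange_injective_of_faithfullyFlat (L := J) (by
      rw [LinearMap.baseChange_comp, LinearMap.baseChange_comp]
      refine LinearMap.ext fun x => θ.injective ?_
      refine (hfx _).trans ?_
      refine ((congrArg (fun y => i (r y)) (hθ g x)).trans ?_).trans (hθ g _).symm
      rw [hfx, r.isIntertwining, i.isIntertwining])⟩
  have hφ : IsIdempotentElem φ := by
    apply Representation.IntertwiningMap.toLinearMap_injective
    apply LinearMap.baseChange_injective_of_faithfullyFlat (L := J)
    change (f ∘ₗ f).baseChange J = f.baseChange J
    rw [LinearMap.baseChange_comp]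
    refine LinearMap.ext fun x => θ.injective ?_
    rw [LinearMap.comp_apply, hfx, hfx, hri]
  obtain ⟨V, j, q, hqj, hjq⟩ := Representation.IntertwiningMap.exists_fdRep_splitting φ hφ
  have hiso : RepIso (repBaseChange J V.ρ) ρX := by
    have hQJ : ∀ v, q.repBaseChange J (j.repBaseChange J v) = v := by
      have : q.toLinearMap ∘ₗ j.toLinearMap = LinearMap.id := LinearMap.ext hqj
      intro v
      change (q.toLinearMap.baseChange J ∘ₗ j.toLinearMap.baseChange J) v = v
      rw [← LinearMap.baseChange_comp, this, LinearMap.baseChange_id, LinearMap.id_apply]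
    have hJQ : ∀ v, Θ (j.repBaseChange J (q.repBaseChange J v)) = i (r (Θ v)) := by
      have : j.toLinearMap ∘ₗ q.toLinearMap = f := LinearMap.ext hjq
      intro v
      change θ ((j.toLinearMap.baseChange J ∘ₗ q.toLinearMap.baseChange J) v) = _
      rw [← LinearMap.baseChange_comp, this]
      exact hfx v
    refine RepIso.of_inverse (r.comp (Θ.comp (j.repBaseChange J)))
      ((q.repBaseChange J).comp (Θ'.comp i)) (fun x => ?_) (fun v => ?_)
    · simp only [Representation.IntertwiningMap.comp_apply]
      rw [hJQ, hΘ, hri, hri]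
    · simp only [Representation.IntertwiningMap.comp_apply]
      rw [← hJQ, hΘ', hQJ, hQJ]
  refine ⟨K, hK, V, ?_, ?_, hiso⟩
  · exact RepIndecomposable.of_repBaseChange (L := J) (hX.of_repIso hiso)
  · exact (repSummand_iff_retract _ _).2 ⟨j, q, hqj⟩
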